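/- Let Γ be a finite generalized layered graph with a unique minimal vertex * with |*| = 0. Let π be a directed path with t(π) = v and l(π) = m. Then e(π,m) ≡ e(v,m) (mod A(Γ)_{f(|v|,m)−1}), i.e., e(π,m) − e(v,m) lies in the filtration subspace A(Γ)_{f(|v|,m)−1}. -/

import Mathlib

open scoped BigOperators

namespace GLG

variable {V E : Type}

def len (tl hd : E → V) (rk : V → ℕ) (e : E) : ℕ := rk (tl e) - rk (hd e)
def IsRank (tl hd : E → V) (rk : V → ℕ) : Prop := ∀ e : E, rk (hd e) < rk (tl e)
def IsPathC (tl hd : E → V) (e : E) (es : List E) : Prop :=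
  List.Chain (fun a b => hd a = tl b) e es
def pathDst (hd : E → V) (e : E) (es : List E) : V :=
  hd ((e :: es).getLast (List.cons_ne_nil e es))
def Reaches (tl hd : E → V) (v w : V) : Prop :=
  ∃ (e : E) (es : List E), IsPathC tl hd e es ∧ tl e = v ∧ pathDst hd e es = w

/-- The set `E^♯` of generators `a_i(e)`, `1 ≤ i ≤ l(e)`. -/
abbrev ESharp (tl hd : E → V) (rk : V → ℕ) : Type :=
  Σ e : E, {i : ℕ // 1 ≤ i ∧ i ≤ len tl hd rk e}

/-- `P_e(t) = 1 + Σ_{j=1}^{l(e)} (-1)^j a_j(e) t^j`. -/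
noncomputable def Pe (F : Type) [Field F] (tl hd : E → V) (rk : V → ℕ) (e : E) :
    Polynomial (FreeAlgebra F (ESharp tl hd rk)) :=
  1 + ∑ j ∈ (Finset.Icc 1 (len tl hd rk e)).attach,
      Polynomial.C ((-1 : FreeAlgebra F (ESharp tl hd rk)) ^ (j : ℕ) *
        FreeAlgebra.ι F (⟨e, ⟨(j : ℕ), (Finset.mem_Icc.mp j.2).1, (Finset.mem_Icc.mp j.2).2⟩⟩ :
          ESharp tl hd rk)) *
      Polynomial.X ^ (j : ℕ)

/-- `e(π, j)`, the coefficient of `(-t)^j` in `P_π(t) = P_{e₁}(t) ⋯ P_{e_r}(t)`,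
for `π` the path given by the list of edges `es`. -/
noncomputable def eP (F : Type) [Field F] (tl hd : E → V) (rk : V → ℕ)
    (es : List E) (j : ℕ) : FreeAlgebra F (ESharp tl hd rk) :=
  (-1 : FreeAlgebra F (ESharp tl hd rk)) ^ j * ((es.map (Pe F tl hd rk)).prod).coeff j

/-- The defining relations of `A(Γ)`: `e(π₁,j) = e(π₂,j)` for paths `π₁, π₂` with the same
tail and the same head, and `1 ≤ j ≤ l(π₁)`. -/
def rel (F : Type) [Field F] (tl hd : E → V) (rk : V → ℕ) :
    FreeAlgebra F (ESharp tl hd rk) → FreeAlgebra F (ESharp tl hd rk) → Prop :=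
  fun x y => ∃ (e1 : E) (es1 : List E) (e2 : E) (es2 : List E) (j : ℕ),
    IsPathC tl hd e1 es1 ∧ IsPathC tl hd e2 es2 ∧
    tl e1 = tl e2 ∧ pathDst hd e1 es1 = pathDst hd e2 es2 ∧
    1 ≤ j ∧ j ≤ rk (tl e1) - rk (pathDst hd e1 es1) ∧
    x = eP F tl hd rk (e1 :: es1) j ∧ y = eP F tl hd rk (e2 :: es2) j

/-- The algebra `A(Γ) = T(E^♯)/R`. -/
noncomputable abbrev AGamma (F : Type) [Field F] (tl hd : E → V) (rk : V → ℕ) : Type :=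
  RingQuot (rel F tl hd rk)

/-- The canonical projection `T(E^♯) → A(Γ)`. -/
noncomputable def mkA (F : Type) [Field F] (tl hd : E → V) (rk : V → ℕ) :
    FreeAlgebra F (ESharp tl hd rk) →ₐ[F] AGamma F tl hd rk :=
  RingQuot.mkAlgHom F (rel F tl hd rk)

/-- `f(a,j) = ja - j(j-1)/2`. -/
def fN (a j : ℕ) : ℕ := j * a - j * (j - 1) / 2

/-- The filtration weight `|a_i(e)| = f(|t(e)|, i)` of a generator. -/
def wt (tl hd : E → V) (rk : V → ℕ) (s : ESharp tl hd rk) : ℕ := fN (rk (tl s.1)) s.2.1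

/-- The filtration subspace `A(Γ)_n`: the span of the images of the products of generators
of total weight at most `n`. -/
noncomputable def filt (F : Type) [Field F] (tl hd : E → V) (rk : V → ℕ) (n : ℕ) :
    Submodule F (AGamma F tl hd rk) :=
  Submodule.span F {x : AGamma F tl hd rk | ∃ w : List (ESharp tl hd rk),
    (w.map (wt tl hd rk)).sum ≤ n ∧ x = mkA F tl hd rk ((w.map (FreeAlgebra.ι F)).prod)}

/-- The degree-`n` homogeneous component `A(Γ)_{[n]}` (for the grading with `deg a_i(e) = i`):
the image in `A(Γ)` of the span of the words of total degree `n`. -/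
noncomputable def gpiece (F : Type) [Field F] (tl hd : E → V) (rk : V → ℕ) (n : ℕ) :
    Submodule F (AGamma F tl hd rk) :=
  Submodule.span F {x : AGamma F tl hd rk | ∃ w : List (ESharp tl hd rk),
    (w.map (fun s => s.2.1)).sum = n ∧ x = mkA F tl hd rk ((w.map (FreeAlgebra.ι F)).prod)}

/-- The Hilbert series `H(A(Γ), z) = Σ_n dim_F A(Γ)_{[n]} · z^n ∈ ℤ[[z]]`. -/
noncomputable def hilb (F : Type) [Field F] (tl hd : E → V) (rk : V → ℕ) : PowerSeries ℤ :=
  PowerSeries.mk fun n => (Module.finrank F (gpiece F tl hd rk n) : ℤ)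


/-- `v ≥ w` in the poset of the graph. -/
def GE (tl hd : E → V) (v w : V) : Prop := v = w ∨ Reaches tl hd v w

/-- The Möbius function of the poset of the graph: the sum of `(-1)^(l+1)` over all
chains `v = v₁ > v₂ > ⋯ > v_l = w`. -/
noncomputable def mob (tl hd : E → V) (v w : V) : ℤ :=
  ∑ᶠ c ∈ {c : List V | c.Chain' (Reaches tl hd) ∧ c.head? = some v ∧ c.getLast? = some w},
    (-1 : ℤ) ^ (c.length + 1)

/-- `M(Γ)(z) = Σ_{v ≥ w} μ(v,w) z^{|v|-|w|}`, as a formal power series over `ℤ`. -/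
noncomputable def MGamma (tl hd : E → V) (rk : V → ℕ) : PowerSeries ℤ :=
  ∑ᶠ p ∈ {p : V × V | GE tl hd p.1 p.2},
    mob tl hd p.1 p.2 • (PowerSeries.X : PowerSeries ℤ) ^ (rk p.1 - rk p.2)

/-- `M_∘(Γ)(z) = Σ_{x ∈ V} μ(x, v_min) z^{|x|-|v_min|}`. -/
noncomputable def MLow (tl hd : E → V) (rk : V → ℕ) (vmin : V) : PowerSeries ℤ :=
  ∑ᶠ x : V, mob tl hd x vmin • (PowerSeries.X : PowerSeries ℤ) ^ (rk x - rk vmin)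

noncomputable def MUp (tl hd : E → V) (rk : V → ℕ) (vmax : V) : PowerSeries ℤ :=
  ∑ᶠ x : V, mob tl hd vmax x • (PowerSeries.X : PowerSeries ℤ) ^ (rk vmax - rk x)

end GLG

namespace GLG

variable {V E : Type}

def Pth (tl hd : E → V) : V → List E → V → Prop
  | u, [], w => u = w
  | u, e :: es, w => tl e = u ∧ Pth tl hd (hd e) es w

lemma Pth_cons_iff (tl hd : E → V) (es : List E) : ∀ (e : E) (u w : V),
    Pth tl hd u (e :: es) w ↔ tl e = u ∧ IsPathC tl hd e es ∧ pathDst hd e es = w := by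
  induction es with
  | nil =>
    intro e u w
    simp [Pth, IsPathC, pathDst, List.Chain]
  | cons a es ih =>
    intro e u w
    have h1 : Pth tl hd u (e :: a :: es) w ↔ tl e = u ∧ Pth tl hd (hd e) (a :: es) w := Iff.rfl
    rw [h1, ih]
    have h2 : pathDst hd e (a :: es) = pathDst hd a es := by
      simp [pathDst]
    have h3 : IsPathC tl hd e (a :: es) ↔ hd e = tl a ∧ IsPathC tl hd a es := by
      simp [IsPathC, List.Chain]
    rw [h2, h3]
    constructor
    · rintro ⟨a, b, c, d⟩; exact ⟨a, ⟨b.symm, c⟩, d⟩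
    · rintro ⟨a, ⟨b, c⟩, d⟩; exact ⟨a, b.symm, c, d⟩

lemma Pth_append (tl hd : E → V) (l2 : List E) (w x : V) (h2 : Pth tl hd w l2 x) (l1 : List E) :
    ∀ u, Pth tl hd u l1 w → Pth tl hd u (l1 ++ l2) x := by
  induction l1 with
  | nil => intro u h; cases h; exact h2
  | cons a l ih => intro u h; exact ⟨h.1, ih _ h.2⟩

lemma Pth_rk (tl hd : E → V) (rk : V → ℕ) (hr : IsRank tl hd rk) (l : List E) :
    ∀ u w, Pth tl hd u l w → rk w ≤ rk u := by
  induction l with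
  | nil => intro u w h; cases h; exact le_rfl
  | cons a l ih =>
    intro u w h
    have := ih _ _ h.2
    have h3 := hr a
    rw [h.1] at h3
    omega

/-- truncated version of `fN` -/
def gN (a j : ℕ) : ℕ := ∑ k ∈ Finset.range j, (a - k)

lemma gN_add (a i k : ℕ) : gN a (i + k) = gN a i + gN (a - i) k := by
  simp [gN, Finset.sum_range_add, Nat.sub_sub]

lemma gN_mono {a b : ℕ} (h : a ≤ b) (j : ℕ) : gN a j ≤ gN b j :=
  Finset.sum_le_sum fun k _ => Nat.sub_le_sub_right h k

lemma gN_lt {a b : ℕ} (h : a < b) (j : ℕ) (hj : 1 ≤ j) : gN a j < gN b j := by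
  obtain ⟨k, rfl⟩ : ∃ k, j = 1 + k := ⟨j - 1, by omega⟩
  rw [gN_add, gN_add]
  have := gN_mono (Nat.sub_le_sub_right h.le 1) k
  have h1 : gN a 1 = a := by simp [gN]
  have h2 : gN b 1 = b := by simp [gN]
  omega

lemma gN_eq (a j : ℕ) (h : j ≤ a) : fN a j = gN a j := by
  have key : gN a j + j * (j - 1) / 2 = j * a := by
    rw [← Finset.sum_range_id_mul_two j, Nat.mul_div_cancel _ (by norm_num), gN,
      ← Finset.sum_add_distrib, Finset.sum_congr rfl (g := fun _ => a)]
    · simp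
    · intro k hk
      have := Finset.mem_range.mp hk
      omega
  unfold fN
  omega

section
variable (F : Type) [Field F] (tl hd : E → V) (rk : V → ℕ)

lemma filt_mono {a b : ℕ} (h : a ≤ b) : filt F tl hd rk a ≤ filt F tl hd rk b := by
  apply Submodule.span_mono
  rintro x ⟨w, hw, rfl⟩
  exact ⟨w, hw.trans h, rfl⟩

lemma filt_mul {a b : ℕ} {x y : AGamma F tl hd rk} (hx : x ∈ filt F tl hd rk a)
    (hy : y ∈ filt F tl hd rk b) : x * y ∈ filt F tl hd rk (a + b) := by
  have h := Submodule.mul_mem_mul hx hy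
  unfold filt at h
  rw [Submodule.span_mul_span] at h
  refine Submodule.span_mono ?_ h
  rintro _ ⟨_, ⟨w, hw, rfl⟩, _, ⟨w', hw', rfl⟩, rfl⟩
  refine ⟨w ++ w', ?_, ?_⟩
  · simp only [List.map_append, List.sum_append]; omega
  · simp

lemma one_mem_filt (a : ℕ) : (1 : AGamma F tl hd rk) ∈ filt F tl hd rk a :=
  Submodule.subset_span ⟨[], by simp, by simp⟩

lemma eP_append (l1 l2 : List E) (m : ℕ) : eP F tl hd rk (l1 ++ l2) m =
    ∑ p ∈ Finset.HasAntidiagonal.antidiagonal m, eP F tl hd rk l1 p.1 * eP F tl hd rk l2 p.2 := by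
  unfold eP
  rw [List.map_append, List.prod_append, Polynomial.coeff_mul, Finset.mul_sum]
  refine Finset.sum_congr rfl fun p hp => ?_
  rw [← Finset.HasAntidiagonal.mem_antidiagonal.mp hp, pow_add]
  have hc : Commute ((-1 : FreeAlgebra F (ESharp tl hd rk)) ^ p.2)
      (((l1.map (Pe F tl hd rk)).prod).coeff p.1) :=
    (Commute.neg_one_left _).pow_left _
  rw [mul_assoc, mul_assoc, ← mul_assoc _ _ (Polynomial.coeff _ p.2), hc.eq, mul_assoc]

lemma eP_zero (l : List E) : eP F tl hd rk l 0 = 1 := by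
  induction l with
  | nil => simp [eP]
  | cons a l ih =>
    have h : eP F tl hd rk ([a] ++ l) 0 = 1 := by
      rw [eP_append]
      simp only [Finset.Nat.antidiagonal_zero, Finset.sum_singleton, ih, mul_one]
      simp only [eP, Pe, List.map_cons, List.map_nil, List.prod_singleton, pow_zero, one_mul,
        Polynomial.coeff_add, Polynomial.coeff_one_zero, Polynomial.finsetSum_coeff]
      rw [Finset.sum_eq_zero, add_zero]
      intro j _
      have := (Finset.mem_Icc.mp j.2).1
      rw [Polynomial.coeff_C_mul_X_pow, if_neg (by omega)]
    exact h

lemma eP_single (e : E) (i : ℕ) (hi : 1 ≤ i) :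
    (∃ h : i ≤ len tl hd rk e, eP F tl hd rk [e] i = FreeAlgebra.ι F ⟨e, ⟨i, hi, h⟩⟩) ∨
    (eP F tl hd rk [e] i = 0) := by
  simp only [eP, Pe, List.map_cons, List.map_nil, List.prod_singleton,
        Polynomial.coeff_add, Polynomial.finsetSum_coeff, Polynomial.coeff_C_mul_X_pow,
        Polynomial.coeff_one, if_neg (show ¬ i = 0 by omega), zero_add]
  by_cases h : i ≤ len tl hd rk e
  · left
    refine ⟨h, ?_⟩
    rw [Finset.sum_eq_single ⟨i, Finset.mem_Icc.mpr ⟨hi, h⟩⟩]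
    · rw [if_pos rfl, ← mul_assoc, ← pow_add, Even.neg_one_pow ⟨i, rfl⟩, one_mul]
    · intro b _ hb
      rw [if_neg]
      intro hh
      exact hb (Subtype.ext hh.symm)
    · intro hh; exact absurd (Finset.mem_attach _ _) hh
  · right
    rw [Finset.sum_eq_zero, mul_zero]
    intro j _
    have := (Finset.mem_Icc.mp j.2).2
    rw [if_neg (by omega)]

lemma eP_mem (hr : IsRank tl hd rk) (l : List E) : ∀ (u w : V) (_ : Pth tl hd u l w) (j : ℕ),
    mkA F tl hd rk (eP F tl hd rk l j) ∈ filt F tl hd rk (gN (rk u) j) := by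
  induction l with
  | nil =>
    intro u w _ j
    rcases Nat.eq_zero_or_pos j with rfl | hj
    · rw [eP_zero, map_one]; exact one_mem_filt F tl hd rk _
    · have : eP F tl hd rk [] j = 0 := by
        simp [eP, Polynomial.coeff_one, hj.ne']
      rw [this, map_zero]; exact Submodule.zero_mem _
  | cons a l ih =>
    intro u w h j
    have hlt := hr a
    have hu := h.1
    rw [show a :: l = [a] ++ l from rfl, eP_append, map_sum]
    refine Submodule.sum_mem _ fun p hp => ?_
    rw [map_mul]
    have h2 := ih _ _ h.2 p.2
    have hp' := Finset.HasAntidiagonal.mem_antidiagonal.mp hp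
    rcases Nat.eq_zero_or_pos p.1 with h0 | hpos
    · rw [h0, eP_zero, map_one, one_mul, ← hp', h0, zero_add]
      refine filt_mono F tl hd rk (gN_mono ?_ _) h2
      rw [← hu]; exact hlt.le
    · rcases eP_single F tl hd rk a p.1 hpos with ⟨hl, he⟩ | he
      · have hl' : p.1 ≤ rk (tl a) - rk (hd a) := hl
        have h1 : mkA F tl hd rk (eP F tl hd rk [a] p.1) ∈ filt F tl hd rk (gN (rk u) p.1) := by
          rw [he]
          refine Submodule.subset_span ⟨[⟨a, ⟨p.1, hpos, hl⟩⟩], ?_, by simp⟩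
          simp only [List.map_cons, List.map_nil, List.sum_singleton, wt]
          rw [gN_eq _ _ (by omega), hu]
        rw [← hp', gN_add]
        refine filt_mul F tl hd rk h1 (filt_mono F tl hd rk (gN_mono ?_ _) h2)
        rw [← hu]; omega
      · rw [he, map_zero, zero_mul]; exact Submodule.zero_mem _

end

end GLG

/-- **Lemma 2.1.** Let `Γ` be a finite generalized layered graph with a unique
minimal vertex `*` with `|*| = 0`.  For each `v ∈ V₊` an edge `e_v` with tail `v` is fixed
(the function `sel`), and `π_v = pathOf v` is the resulting path from `v` to `*`
(`pathOf * = []` and `pathOf v = sel v :: pathOf (h (sel v))` for `v ≠ *`); `e(v,j)` is the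
image in `A(Γ)` of `e(π_v, j)`.  If `π = (e :: es)` is a directed path with tail `v` and
length `m`, then `e(π, m) ≡ e(v, m)` modulo the filtration subspace `A(Γ)_{f(|v|, m) - 1}`. -/
theorem ePath_congr_eV (F : Type) [Field F] {V E : Type} [Fintype V] [Fintype E]
    (tl hd : E → V) (rk : V → ℕ) (hrank : GLG.IsRank tl hd rk)
    (star : V) (hstar0 : rk star = 0)
    (hmin : ∀ v : V, (∀ e : E, tl e ≠ v) ↔ v = star)
    (sel : V → E) (hsel : ∀ v : V, v ≠ star → tl (sel v) = v)
    (pathOf : V → List E)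
    (hpathOf0 : pathOf star = [])
    (hpathOfS : ∀ v : V, v ≠ star → pathOf v = sel v :: pathOf (hd (sel v)))
    (e : E) (es : List E) (hpath : GLG.IsPathC tl hd e es)
    (v : V) (hv : tl e = v)
    (m : ℕ) (hm : m = rk v - rk (GLG.pathDst hd e es)) :
    GLG.mkA F tl hd rk (GLG.eP F tl hd rk (e :: es) m) -
        GLG.mkA F tl hd rk (GLG.eP F tl hd rk (pathOf v) m) ∈
      GLG.filt F tl hd rk (GLG.fN (rk v) m - 1) := by
  have hP : ∀ n : ℕ, ∀ u : V, rk u ≤ n → GLG.Pth tl hd u (pathOf u) star := by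
    intro n
    induction n with
    | zero =>
      intro u hu
      by_cases hs : u = star
      · rw [hs, hpathOf0]; rfl
      · have := hrank (sel u)
        rw [hsel u hs] at this
        omega
    | succ n ih =>
      intro u hu
      by_cases hs : u = star
      · rw [hs, hpathOf0]; rfl
      · have := hrank (sel u)
        rw [hsel u hs] at this
        rw [hpathOfS u hs]
        exact ⟨hsel u hs, ih _ (by omega)⟩
  set w := GLG.pathDst hd e es with hw
  have hπ : GLG.Pth tl hd v (e :: es) w :=
    (GLG.Pth_cons_iff tl hd es e v w).2 ⟨hv, hpath, rfl⟩
  have hwp := hP _ w le_rfl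
  have hvp := hP _ v le_rfl
  have hvs : v ≠ star := fun h => (hmin v).2 h e hv
  have hlt : rk w < rk v := by
    have h1 := GLG.Pth_rk tl hd rk hrank _ _ _ hπ.2
    have h2 := hrank e
    rw [hv] at h2
    omega
  have hcat := GLG.Pth_append tl hd _ w star hwp _ v hπ
  have heq : GLG.mkA F tl hd rk (GLG.eP F tl hd rk (pathOf v) m) =
      GLG.mkA F tl hd rk (GLG.eP F tl hd rk ((e :: es) ++ pathOf w) m) := by
    rw [hpathOfS v hvs] at hvp ⊢
    obtain ⟨a1, a2, a3⟩ := (GLG.Pth_cons_iff ..).1 hvp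
    obtain ⟨b1, b2, b3⟩ := (GLG.Pth_cons_iff ..).1 hcat
    refine RingQuot.mkAlgHom_rel F ⟨_, _, _, _, m, a2, b2, a1.trans b1.symm, a3.trans b3.symm,
      by omega, ?_, rfl, rfl⟩
    rw [a1, a3, hstar0]
    omega
  rw [heq, GLG.eP_append, map_sum,
    ← Finset.add_sum_erase _ _ (show (m, 0) ∈ Finset.HasAntidiagonal.antidiagonal m by simp)]
  simp only [map_mul, GLG.eP_zero, map_one, mul_one]
  rw [sub_add_cancel_left]
  refine Submodule.neg_mem _ (Submodule.sum_mem _ fun p hp => ?_)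
  obtain ⟨hne, hp'⟩ := Finset.mem_erase.mp hp
  have hp' := Finset.HasAntidiagonal.mem_antidiagonal.mp hp'
  have hj : 1 ≤ p.2 := by
    by_contra hc
    exact hne (Prod.ext (by simp; omega) (by simp; omega))
  refine GLG.filt_mono F tl hd rk ?_ (GLG.filt_mul F tl hd rk
    (GLG.eP_mem F tl hd rk hrank _ _ _ hπ p.1) (GLG.eP_mem F tl hd rk hrank _ _ _ hwp p.2))
  rw [GLG.gN_eq _ _ (by omega)]
  have h1 := GLG.gN_add (rk v) p.1 p.2
  rw [hp'] at h1
  have h2 := GLG.gN_lt (show rk w < rk v - p.1 by omega) p.2 hj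
  omega
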